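/- arXiv:2011.12478 — 2 statements merged into one kernel-verified Lean document; each statement's English description precedes it below -/
import Mathlib

section
/- Let k ≥ 2, let K ⊆ ℝ^{k−1} be a convex set, and let g : [a,b] → ℝ be continuous such that the curve t ↦ (t, g(t)) has finite length. Define L : [a,b] → ℝ by L(t) := length of s ↦ (s, g(s)) over [a,t], and let C := {(u, t, g(t)) : u ∈ K, t ∈ [a,b]} ⊆ ℝ^{k+1}. Then for all u, u' ∈ K and t, t' ∈ [a,b], the intrinsic distance on C satisfies d_C((u, t, g(t)), (u', t', g(t'))) = √(‖u − u'‖² + (L(t) − L(t'))²). (In other words, the map (u, t, g(t)) ↦ (u, L(t)) is an isometry from C, with its intrinsic metric, onto the convex set K × [0, L(b)] ⊆ ℝ^k.) -/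
open Set
open scoped ENNReal

/-- The intrinsic distance on a set `A`: the infimum of the lengths (total variations) of
continuous curves `γ : [0,1] → A` joining the two points, in `[0,∞]`. -/
noncomputable def intrinsicDist {E : Type*} [PseudoEMetricSpace E] (A : Set E) (x x' : E) :
    ℝ≥0∞ :=
  sInf {L | ∃ γ : ℝ → E, ContinuousOn γ (Icc 0 1) ∧ MapsTo γ (Icc 0 1) A ∧
    γ 0 = x ∧ γ 1 = x' ∧ L = eVariationOn γ (Icc 0 1)}

/-- The point `(u, t, z) ∈ ℝ^{k−1} × ℝ × ℝ = ℝ^{k+1}`, with the Euclidean (ℓ²) norm. -/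
noncomputable def embCyl {k : ℕ} (u : EuclideanSpace ℝ (Fin (k - 1))) (t z : ℝ) :
    WithLp 2 (EuclideanSpace ℝ (Fin (k - 1)) × WithLp 2 (ℝ × ℝ)) :=
  (WithLp.equiv 2 _).symm (u, (WithLp.equiv 2 (ℝ × ℝ)).symm (t, z))

/-- A continuous path from `t` to `t'` in `ℝ` has a monotone right inverse on `[t, t']`. -/
theorem exists_monotoneOn_rightInvOn {τ : ℝ → ℝ} (hτ : ContinuousOn τ (Icc 0 1))
    (hlt : τ 0 < τ 1) :
    ∃ ρ : ℝ → ℝ, MonotoneOn ρ (Icc (τ 0) (τ 1)) ∧ MapsTo ρ (Icc (τ 0) (τ 1)) (Icc 0 1) ∧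
      ρ (τ 0) = 0 ∧ ρ (τ 1) = 1 ∧ ∀ p ∈ Icc (τ 0) (τ 1), τ (ρ p) = p := by
  have hleast : ∀ p ∈ Icc (τ 0) (τ 1), ∃ s, IsLeast (Icc 0 1 ∩ τ ⁻¹' Ici p) s := by
    intro p hp
    have hc : IsClosed (Icc (0 : ℝ) 1 ∩ τ ⁻¹' Ici p) :=
      hτ.preimage_isClosed_of_isClosed isClosed_Icc isClosed_Ici
    exact (isCompact_Icc.of_isClosed_subset hc inter_subset_left).exists_isLeast
      ⟨1, ⟨zero_le_one, le_rfl⟩, hp.2⟩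
  choose! σ hσ using hleast
  have hσeq : ∀ p ∈ Icc (τ 0) (τ 1), τ (σ p) = p := by
    intro p hp
    obtain ⟨⟨h01, hge⟩, hmin⟩ := hσ p hp
    obtain ⟨s, hs, hsp⟩ := intermediate_value_Icc h01.1
      (hτ.mono (Icc_subset_Icc_right h01.2)) ⟨hp.1, hge⟩
    have : σ p ≤ s := hmin ⟨⟨hs.1, hs.2.trans h01.2⟩, hsp.ge⟩
    rw [le_antisymm this hs.2, hsp]
  refine ⟨fun p => if p = τ 1 then 1 else σ p, ?_, ?_, ?_, by simp, ?_⟩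
  · intro p hp q hq hpq
    dsimp only
    by_cases hq1 : q = τ 1
    · rw [if_pos hq1]
      split_ifs
      · exact le_rfl
      · exact (hσ p hp).1.1.2
    · have hp1 : p ≠ τ 1 := fun h => hq1 (le_antisymm hq.2 (h ▸ hpq))
      rw [if_neg hq1, if_neg hp1]
      exact (hσ p hp).2 ⟨(hσ q hq).1.1, hpq.trans (hσ q hq).1.2⟩
  · intro p hp
    dsimp only
    split_ifs
    · simp
    · exact (hσ p hp).1.1
  · have h0 : τ 0 ∈ Icc (τ 0) (τ 1) := ⟨le_rfl, hlt.le⟩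
    simp only [if_neg hlt.ne]
    exact le_antisymm ((hσ _ h0).2 ⟨by simp, le_refl (τ 0)⟩) (hσ _ h0).1.1.1
  · intro p hp
    dsimp only
    split_ifs with h
    · exact h.symm
    · exact hσeq p hp

theorem eVariationOn_Icc_add_Icc {M : Type*} [PseudoEMetricSpace M] (f : ℝ → M) {p q r : ℝ}
    (hpq : p ≤ q) (hqr : q ≤ r) :
    eVariationOn f (Icc p q) + eVariationOn f (Icc q r) = eVariationOn f (Icc p r) := by
  simpa using eVariationOn.Icc_add_Icc f hpq hqr (mem_univ q)

/-- Minkowski's inequality for two vectors in the plane. -/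
theorem sqrt_add_sq_add_sq_le (a b c d : ℝ) :
    √((a + c) ^ 2 + (b + d) ^ 2) ≤ √(a ^ 2 + b ^ 2) + √(c ^ 2 + d ^ 2) := by
  have h := norm_add_le (WithLp.toLp 2 (a, b)) (WithLp.toLp 2 (c, d))
  simpa [WithLp.prod_norm_eq_of_L2, ← WithLp.toLp_add] using h

section Product

variable {E F : Type*} [NormedAddCommGroup E] [NormedAddCommGroup F]

theorem edist_withLp_prod (x y : WithLp 2 (E × F)) :
    edist x y = ENNReal.ofReal √(‖x.fst - y.fst‖ ^ 2 + ‖x.snd - y.snd‖ ^ 2) := by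
  rw [edist_dist, dist_eq_norm, WithLp.prod_norm_eq_of_L2]
  rfl

theorem ofReal_sqrt_le_eVariationOn_Icc_trans (f : ℝ → WithLp 2 (E × F)) {p y z S d : ℝ}
    (hpy : p ≤ y) (hyz : y ≤ z) (hd : 0 ≤ d) (hdle : d ≤ ‖(f z).snd - (f y).snd‖)
    (h : ENNReal.ofReal √(‖(f y).fst - (f p).fst‖ ^ 2 + S ^ 2) ≤ eVariationOn f (Icc p y)) :
    ENNReal.ofReal √(‖(f z).fst - (f p).fst‖ ^ 2 + (S + d) ^ 2) ≤ eVariationOn f (Icc p z) := by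
  rw [← eVariationOn_Icc_add_Icc f hpy hyz]
  have hedist : edist (f z) (f y) ≤ eVariationOn f (Icc y z) :=
    eVariationOn.edist_le f ⟨hyz, le_rfl⟩ ⟨le_rfl, hyz⟩
  refine le_trans ?_ (add_le_add h hedist)
  rw [edist_withLp_prod, ← ENNReal.ofReal_add (Real.sqrt_nonneg _) (Real.sqrt_nonneg _)]
  refine ENNReal.ofReal_le_ofReal (le_trans ?_ ((sqrt_add_sq_add_sq_le _ _ _ _).trans
    (add_le_add_right (Real.sqrt_le_sqrt (?_ : ‖(f z).fst - (f y).fst‖ ^ 2 + d ^ 2 ≤ _)) _)))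
  · refine Real.sqrt_le_sqrt ?_
    gcongr
    have := norm_add_le ((f y).fst - (f p).fst) ((f z).fst - (f y).fst)
    rwa [show (f y).fst - (f p).fst + ((f z).fst - (f y).fst) = (f z).fst - (f p).fst by abel]
      at this
  · gcongr

/-- The length of a curve in an `ℓ²`-product is at least the hypotenuse of the displacement of
its first component and the length of its second component. -/
theorem ofReal_sqrt_le_eVariationOn (f : ℝ → WithLp 2 (E × F)) {p q : ℝ} (hpq : p ≤ q) :
    ENNReal.ofReal √(‖(f q).fst - (f p).fst‖ ^ 2 +
      (eVariationOn (fun s => (f s).snd) (Icc p q)).toReal ^ 2) ≤ eVariationOn f (Icc p q) := by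
  have hsum : ∀ (n : ℕ) (x : ℕ → ℝ), Monotone x → (∀ i, x i ∈ Icc p q) →
      ENNReal.ofReal √(‖(f q).fst - (f p).fst‖ ^ 2 +
        (∑ i ∈ Finset.range n, ‖(f (x (i + 1))).snd - (f (x i)).snd‖) ^ 2) ≤
        eVariationOn f (Icc p q) := by
    intro n x hx hxm
    have key : ∀ m, ENNReal.ofReal √(‖(f (x m)).fst - (f p).fst‖ ^ 2 +
        (∑ i ∈ Finset.range m, ‖(f (x (i + 1))).snd - (f (x i)).snd‖) ^ 2) ≤
        eVariationOn f (Icc p (x m)) := by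
      intro m
      induction m with
      | zero =>
        have h0 := ofReal_sqrt_le_eVariationOn_Icc_trans f (S := 0) (d := 0) (le_refl p) (hxm 0).1
          le_rfl (norm_nonneg _) (by simp)
        simpa using h0
      | succ m ih =>
        rw [Finset.sum_range_succ]
        exact ofReal_sqrt_le_eVariationOn_Icc_trans f (hxm m).1 (hx m.le_succ)
          (norm_nonneg _) le_rfl ih
    simpa using ofReal_sqrt_le_eVariationOn_Icc_trans f (d := 0) (hxm n).1 (hxm n).2 le_rfl
      (norm_nonneg _) (key n)
  rcases eq_or_ne (eVariationOn f (Icc p q)) ⊤ with htop | htop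
  · simp [htop]
  set v := (eVariationOn f (Icc p q)).toReal
  set D := ‖(f q).fst - (f p).fst‖
  have hv0 : 0 ≤ v := ENNReal.toReal_nonneg
  have hsum' : ∀ (n : ℕ) (x : ℕ → ℝ), Monotone x → (∀ i, x i ∈ Icc p q) →
      D ^ 2 + (∑ i ∈ Finset.range n, ‖(f (x (i + 1))).snd - (f (x i)).snd‖) ^ 2 ≤ v ^ 2 := by
    intro n x hx hxm
    have := (ENNReal.ofReal_le_iff_le_toReal htop).1 (hsum n x hx hxm)
    exact (Real.sqrt_le_left hv0).1 this
  have hD : D ^ 2 ≤ v ^ 2 := by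
    simpa using hsum' 0 (fun _ => p) monotone_const (fun _ => ⟨le_rfl, hpq⟩)
  have hle : eVariationOn (fun s => (f s).snd) (Icc p q) ≤ ENNReal.ofReal √(v ^ 2 - D ^ 2) := by
    refine iSup_le ?_
    rintro ⟨n, x, hx, hxm⟩
    simp only [edist_dist, dist_eq_norm]
    rw [← ENNReal.ofReal_sum_of_nonneg fun _ _ => norm_nonneg _]
    refine ENNReal.ofReal_le_ofReal (Real.le_sqrt_of_sq_le ?_)
    linarith [hsum' n x hx hxm]
  refine (ENNReal.ofReal_le_iff_le_toReal htop).2 ((Real.sqrt_le_left hv0).2 ?_)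
  have h1 := ENNReal.toReal_mono ENNReal.ofReal_ne_top hle
  rw [ENNReal.toReal_ofReal (Real.sqrt_nonneg _)] at h1
  have h2 := pow_le_pow_left₀ ENNReal.toReal_nonneg h1 2
  rw [Real.sq_sqrt (by linarith)] at h2
  linarith

end Product

theorem intrinsicDist_comm {M : Type*} [PseudoEMetricSpace M] (A : Set M) (x y : M) :
    intrinsicDist A x y = intrinsicDist A y x := by
  have hle : ∀ x y : M, intrinsicDist A x y ≤ intrinsicDist A y x := by
    intro x y
    refine le_sInf ?_
    rintro _ ⟨c, hc, hcA, h0, h1, rfl⟩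
    have hmaps : MapsTo (fun s : ℝ => 1 - s) (Icc 0 1) (Icc 0 1) := fun s hs =>
      ⟨by linarith [hs.2], by linarith [hs.1]⟩
    refine le_trans (b := eVariationOn (c ∘ fun s => 1 - s) (Icc 0 1))
      (sInf_le ⟨c ∘ fun s => 1 - s, hc.comp (by fun_prop) hmaps, hcA.comp hmaps, by simp [h1],
        by simp [h0], rfl⟩) (eVariationOn.comp_le_of_antitoneOn c _ ?_ hmaps)
    intro s _ r _ hsr
    dsimp only
    linarith
  exact le_antisymm (hle x y) (hle y x)

section ArcLength

variable {M : Type*} [PseudoEMetricSpace M] {f : ℝ → M} {a b : ℝ}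

theorem toReal_eVariationOn_Icc_sub (hfin : eVariationOn f (Icc a b) ≠ ⊤) {s t : ℝ}
    (has : a ≤ s) (hst : s ≤ t) (htb : t ≤ b) :
    (eVariationOn f (Icc a t)).toReal - (eVariationOn f (Icc a s)).toReal =
      (eVariationOn f (Icc s t)).toReal := by
  have hne : ∀ {x y : ℝ}, a ≤ x → y ≤ b → eVariationOn f (Icc x y) ≠ ⊤ := fun hx hy =>
    ne_top_of_le_ne_top hfin (eVariationOn.mono f (Icc_subset_Icc hx hy))
  rw [← eVariationOn_Icc_add_Icc f has hst,
    ENNReal.toReal_add (hne le_rfl (hst.trans htb)) (hne has htb), add_sub_cancel_left]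

theorem continuousOn_toReal_eVariationOn_Icc (hfin : eVariationOn f (Icc a b) ≠ ⊤)
    (hf : ContinuousOn f (Icc a b)) :
    ContinuousOn (fun t => (eVariationOn f (Icc a t)).toReal) (Icc a b) := by
  intro x hx
  have hleft := BoundedVariationOn.tendsto_eVariationOn_Icc_zero_left (s := Icc a b) hfin
    ((hf x hx).mono (inter_subset_left (t := Iic x)))
  have hright := BoundedVariationOn.tendsto_eVariationOn_Icc_zero_right (s := Icc a b) hfin x
    ((hf x hx).mono (inter_subset_left (t := Ici x)))
  have hlim := ((ENNReal.tendsto_toReal ENNReal.zero_ne_top).comp hleft).add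
    ((ENNReal.tendsto_toReal ENNReal.zero_ne_top).comp hright)
  simp only [ENNReal.toReal_zero, add_zero] at hlim
  rw [ContinuousWithinAt, tendsto_iff_dist_tendsto_zero]
  refine squeeze_zero' (Filter.Eventually.of_forall fun _ => dist_nonneg) ?_ hlim
  filter_upwards [self_mem_nhdsWithin] with y hy
  simp only [Function.comp_apply]
  rw [Real.dist_eq]
  rcases le_total x y with hxy | hxy
  · rw [toReal_eVariationOn_Icc_sub hfin hx.1 hxy hy.2, abs_of_nonneg ENNReal.toReal_nonneg,
      inter_eq_right.2 (Icc_subset_Icc hx.1 hy.2)]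
    exact le_add_of_nonneg_left ENNReal.toReal_nonneg
  · rw [abs_sub_comm, toReal_eVariationOn_Icc_sub hfin hy.1 hxy hx.2,
      abs_of_nonneg ENNReal.toReal_nonneg, inter_eq_right.2 (Icc_subset_Icc hy.1 hx.2)]
    exact le_add_of_nonneg_right ENNReal.toReal_nonneg

end ArcLength

theorem norm_sub_le_abs_toReal_eVariationOn_Icc_sub {F : Type*} [NormedAddCommGroup F]
    {f : ℝ → F} {a b : ℝ} (hfin : eVariationOn f (Icc a b) ≠ ⊤) {s t : ℝ}
    (hs : s ∈ Icc a b) (ht : t ∈ Icc a b) :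
    ‖f s - f t‖ ≤ |(eVariationOn f (Icc a s)).toReal - (eVariationOn f (Icc a t)).toReal| := by
  wlog hst : s ≤ t generalizing s t
  · rw [norm_sub_rev, abs_sub_comm]
    exact this ht hs (le_of_not_ge hst)
  rw [abs_sub_comm, toReal_eVariationOn_Icc_sub hfin hs.1 hst ht.2,
    abs_of_nonneg ENNReal.toReal_nonneg, ← dist_eq_norm, dist_edist]
  exact ENNReal.toReal_mono
    (ne_top_of_le_ne_top hfin (eVariationOn.mono f (Icc_subset_Icc hs.1 ht.2)))
    (eVariationOn.edist_le f ⟨le_rfl, hst⟩ ⟨hst, le_rfl⟩)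

/-- Let `k ≥ 2`, `K ⊆ ℝ^{k−1}` convex, `g : [a,b] → ℝ` continuous with the
curve `t ↦ (t, g(t))` of finite length, `L(t)` the length of this curve over `[a,t]`, and
`C := {(u, t, g(t)) : u ∈ K, t ∈ [a,b]} ⊆ ℝ^{k+1}`. Then the intrinsic distance on `C`
satisfies `d_C((u,t,g(t)), (u',t',g(t'))) = √(‖u − u'‖² + (L(t) − L(t'))²)`. -/
theorem intrinsicDist_cylinder_over_graph (k : ℕ) (hk : 2 ≤ k)
    (K : Set (EuclideanSpace ℝ (Fin (k - 1)))) (hK : Convex ℝ K)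
    (a b : ℝ) (hab : a ≤ b) (g : ℝ → ℝ) (hg : ContinuousOn g (Icc a b))
    (γ : ℝ → WithLp 2 (ℝ × ℝ)) (hγ : γ = fun τ => (WithLp.equiv 2 (ℝ × ℝ)).symm (τ, g τ))
    (hfin : eVariationOn γ (Icc a b) ≠ ⊤)
    (L : ℝ → ℝ) (hL : ∀ t, L t = (eVariationOn γ (Icc a t)).toReal)
    (C : Set (WithLp 2 (EuclideanSpace ℝ (Fin (k - 1)) × WithLp 2 (ℝ × ℝ))))
    (hC : C = {p | ∃ u ∈ K, ∃ t ∈ Icc a b, p = embCyl u t (g t)}) :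
    ∀ u ∈ K, ∀ u' ∈ K, ∀ t ∈ Icc a b, ∀ t' ∈ Icc a b,
      intrinsicDist C (embCyl u t (g t)) (embCyl u' t' (g t')) =
        ENNReal.ofReal (Real.sqrt (‖u - u'‖ ^ 2 + (L t - L t') ^ 2)) := by
  subst hγ
  set γ : ℝ → WithLp 2 (ℝ × ℝ) := fun τ => (WithLp.equiv 2 (ℝ × ℝ)).symm (τ, g τ)
  have hγc : ContinuousOn γ (Icc a b) := by
    refine (WithLp.prod_continuous_toLp 2 ℝ ℝ).comp_continuousOn (continuousOn_id.prodMk hg)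
  have hγfst : ∀ τ, (γ τ).fst = τ := fun _ => rfl
  have hsnd : ∀ (u : EuclideanSpace ℝ (Fin (k - 1))) τ, (embCyl u τ (g τ)).snd = γ τ :=
    fun _ _ => rfl
  have hfst : ∀ (u : EuclideanSpace ℝ (Fin (k - 1))) τ, (embCyl u τ (g τ)).fst = u :=
    fun _ _ => rfl
  have hLc : ContinuousOn L (Icc a b) := by
    rw [show L = _ from funext hL]
    exact continuousOn_toReal_eVariationOn_Icc hfin hγc
  have hLsub : ∀ {s t : ℝ}, s ∈ Icc a b → t ∈ Icc a b → s ≤ t →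
      L t - L s = (eVariationOn γ (Icc s t)).toReal := by
    intro s t hs ht hst
    rw [hL, hL]
    exact toReal_eVariationOn_Icc_sub hfin hs.1 hst ht.2
  have hLnorm : ∀ {s t : ℝ}, s ∈ Icc a b → t ∈ Icc a b → ‖γ s - γ t‖ ≤ |L s - L t| := by
    intro s t hs ht
    rw [hL, hL]
    exact norm_sub_le_abs_toReal_eVariationOn_Icc_sub hfin hs ht
  intro u hu u' hu' t ht t' ht'
  wlog htt : t ≤ t' generalizing u u' t t'
  · rw [intrinsicDist_comm, this u' hu' u hu t' ht' t ht (le_of_not_ge htt), norm_sub_rev,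
      ← sq_abs (L t' - L t), abs_sub_comm, sq_abs]
  apply le_antisymm
  · have hLtt : L t ≤ L t' := by
      have := hLsub ht ht' htt
      have : 0 ≤ (eVariationOn γ (Icc t t')).toReal := ENNReal.toReal_nonneg
      linarith
    have hpre : ∀ s ∈ Icc (0 : ℝ) 1, ∃ τ ∈ Icc a b, L τ = L t + s * (L t' - L t) := by
      intro s hs
      obtain ⟨τ, hτ, h⟩ := intermediate_value_Icc htt
        (hLc.mono (Icc_subset_Icc ht.1 ht'.2)) (show L t + s * (L t' - L t) ∈ _ from
          ⟨by nlinarith [hs.1], by nlinarith [hs.2]⟩)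
      exact ⟨τ, ⟨ht.1.trans hτ.1, hτ.2.trans ht'.2⟩, h⟩
    choose! σ hσ hLσ using hpre
    have h0 : (0 : ℝ) ∈ Icc (0 : ℝ) 1 := by simp
    have h1 : (1 : ℝ) ∈ Icc (0 : ℝ) 1 := by simp
    have hσeq : ∀ {s r : ℝ}, s ∈ Icc (0 : ℝ) 1 → r ∈ Icc a b → L (σ s) = L r → σ s = r := by
      intro s r hs hr h
      have hn := hLnorm (hσ s hs) hr
      rw [h, sub_self, abs_zero] at hn
      have := sub_eq_zero.1 (norm_le_zero_iff.1 hn)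
      rw [← hγfst (σ s), this, hγfst]
    set c : ℝ → WithLp 2 (EuclideanSpace ℝ (Fin (k - 1)) × WithLp 2 (ℝ × ℝ)) :=
      fun s => embCyl (u + s • (u' - u)) (σ s) (g (σ s)) with hcdef
    have hlip : LipschitzOnWith (Real.toNNReal √(‖u - u'‖ ^ 2 + (L t - L t') ^ 2)) c (Icc 0 1) := by
      intro s hs r hr
      rw [edist_withLp_prod, edist_dist, Real.dist_eq, ENNReal.ofNNReal_toNNReal,
        ← ENNReal.ofReal_mul (Real.sqrt_nonneg _)]
      refine ENNReal.ofReal_le_ofReal (Real.sqrt_le_iff.2 ⟨by positivity, ?_⟩)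
      rw [mul_pow, Real.sq_sqrt (by positivity), sq_abs, hcdef, hfst, hfst, hsnd, hsnd,
        show u + s • (u' - u) - (u + r • (u' - u)) = (r - s) • (u - u') by module, norm_smul,
        mul_pow, Real.norm_eq_abs, sq_abs]
      have h := pow_le_pow_left₀ (norm_nonneg _) (hLnorm (hσ s hs) (hσ r hr)) 2
      rw [sq_abs, hLσ s hs, hLσ r hr] at h
      nlinarith
    have hvar : eVariationOn c (Icc 0 1) ≤
        ENNReal.ofReal √(‖u - u'‖ ^ 2 + (L t - L t') ^ 2) := by
      have h := hlip.comp_eVariationOn_le (mapsTo_id _)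
      rwa [eVariationOn_id_Icc, sub_zero, ENNReal.ofReal_one, mul_one] at h
    refine le_trans (b := eVariationOn c (Icc 0 1))
      (sInf_le ⟨c, hlip.continuousOn, ?_, ?_, ?_, rfl⟩) hvar
    · intro s hs
      rw [hC]
      exact ⟨_, hK.add_smul_sub_mem hu hu' hs, σ s, hσ s hs, rfl⟩
    · have := hσeq h0 ht (by rw [hLσ 0 h0]; ring)
      simp [hcdef, this]
    · have := hσeq h1 ht' (by rw [hLσ 1 h1]; ring)
      simp [hcdef, this]
  · refine le_sInf ?_
    rintro _ ⟨c, hc, hcC, hc0, hc1, rfl⟩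
    have hcγ : ∀ s ∈ Icc (0 : ℝ) 1, (c s).snd = γ (c s).snd.fst := by
      intro s hs
      have := hcC hs
      rw [hC] at this
      obtain ⟨v, -, r, -, h⟩ := this
      rw [h]
      rfl
    rcases htt.eq_or_lt with rfl | hlt
    · have h := eVariationOn.edist_le c (s := Icc (0 : ℝ) 1) (x := 0) (y := 1) (by simp) (by simp)
      rw [hc0, hc1, edist_withLp_prod, hfst, hfst, hsnd, hsnd] at h
      simpa using h
    · set τ : ℝ → ℝ := fun s => (c s).snd.fst with hτ
      have hτc : ContinuousOn τ (Icc 0 1) := by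
        have hcont : Continuous fun x : WithLp 2
            (EuclideanSpace ℝ (Fin (k - 1)) × WithLp 2 (ℝ × ℝ)) => x.snd.fst :=
          ((WithLp.prod_continuous_ofLp 2 _ _).comp
            (WithLp.prod_continuous_ofLp 2 _ _).snd).fst
        exact hcont.comp_continuousOn hc
      have hτ0 : τ 0 = t := by rw [hτ]; dsimp only; rw [hc0, hsnd, hγfst]
      have hτ1 : τ 1 = t' := by rw [hτ]; dsimp only; rw [hc1, hsnd, hγfst]
      obtain ⟨ρ, hmono, hmaps, hρ0, hρ1, hρ⟩ :=
        exists_monotoneOn_rightInvOn hτc (by rwa [hτ0, hτ1])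
      rw [hτ0, hτ1] at hmono hmaps hρ
      rw [hτ0] at hρ0
      rw [hτ1] at hρ1
      refine le_trans ?_ (eVariationOn.comp_le_of_monotoneOn c ρ hmono hmaps)
      have h := ofReal_sqrt_le_eVariationOn (c ∘ ρ) htt
      have hcongr : eVariationOn (fun s => ((c ∘ ρ) s).snd) (Icc t t') =
          eVariationOn γ (Icc t t') :=
        eVariationOn.congr fun p hp => by
          change (c (ρ p)).snd = γ p
          rw [hcγ _ (hmaps hp)]
          exact congrArg γ (hρ p hp)
      rw [hcongr, ← hLsub ht ht' htt] at h
      simp only [Function.comp_apply] at h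
      rw [hρ0, hρ1, hc0, hc1, hfst, hfst, norm_sub_rev, ← sq_abs (L t' - L t), abs_sub_comm,
        sq_abs] at h
      exact h
end

section
/- In the k-dimensional grid setting below, suppose C₂ε² ≤ C₁/2 and C₁ε² ≤ 1, where C₁ := (A²/16)·∫_{−1}^{1} w'(t)² dt and C₂ := (A⁴/256)·∫_{−1}^{1} w'(t)⁴ dt. Then for all i ≠ j in {1,…,m}^k, d_{M₂}(x_i, x_j) − d_{M₁}(x_i, x_j) ≥ (C₁/3)·ε²·β_{ij}²·d_{M₁}(x_i, x_j), where β_{ij} := |i_k − j_k|·ε / d_{M₁}(x_i, x_j) is the cosine of the angle that the line through x_i and x_j makes with the k-th coordinate axis. -/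
open Set
open scoped ENNReal

/-- The point `(t₁, …, t_k, z) ∈ ℝ^{k+1}` (as `EuclideanSpace ℝ (Fin (k+1))`). -/
noncomputable def embGraph {k : ℕ} (t : Fin k → ℝ) (z : ℝ) :
    EuclideanSpace ℝ (Fin (k + 1)) :=
  (WithLp.equiv 2 (Fin (k + 1) → ℝ)).symm (Fin.snoc t z)

/-- The tri-cube function `w(t) = (1 − |t|³)₊³`. -/
noncomputable def triCube (t : ℝ) : ℝ := (max (1 - |t| ^ 3) 0) ^ 3

/-- The bump-train function `g(t) = A(ε/2)²·Σ_{i=1}^{m−1} w((t − (i−1/2)ε)/(ε/2))`. -/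
noncomputable def bumpTrain (A ε : ℝ) (m : ℕ) (t : ℝ) : ℝ :=
  A * (ε / 2) ^ 2 * ∑ i ∈ Finset.range (m - 1), triCube ((t - ((i : ℝ) + 1 / 2) * ε) / (ε / 2))

theorem edist_le_intrinsicDist {E F : Type*} [PseudoMetricSpace E] [PseudoMetricSpace F]
    {A : Set E} {Φ : E → F}
    (h : ∀ δ > 0, ∃ η > 0, ∀ p ∈ A, ∀ p' ∈ A, dist p p' < η →
      dist (Φ p) (Φ p') ≤ (1 + δ) * dist p p') (x x' : E) :
    edist (Φ x) (Φ x') ≤ intrinsicDist A x x' := by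
  refine le_sInf ?_
  rintro _ ⟨γ, hγ, hmaps, rfl, rfl, rfl⟩
  rcases eq_or_ne (eVariationOn γ (Icc 0 1)) ⊤ with hL | hL
  · simp [hL]
  have key : ∀ δ : ℝ, 0 < δ →
      edist (Φ (γ 0)) (Φ (γ 1)) ≤ ENNReal.ofReal (1 + δ) * eVariationOn γ (Icc 0 1) := by
    intro δ hδ
    obtain ⟨η, hη, H⟩ := h δ hδ
    obtain ⟨θ, hθ, hu⟩ := Metric.uniformContinuousOn_iff.1
      (isCompact_Icc.uniformContinuousOn_of_continuous hγ) η hη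
    obtain ⟨N, hN⟩ := exists_nat_one_div_lt hθ
    have hN0 : (0 : ℝ) < (N : ℝ) + 1 := by positivity
    set u : ℕ → ℝ := fun i => (i : ℝ) / ((N : ℝ) + 1) with hu_def
    have humem : ∀ i ∈ Iic (N + 1), u i ∈ Icc (0 : ℝ) 1 := by
      intro i hi
      have : (i : ℝ) ≤ (N : ℝ) + 1 := by exact_mod_cast hi
      exact ⟨by positivity, (div_le_one hN0).2 this⟩
    have hmono : MonotoneOn u (Iic (N + 1)) := by
      intro a _ b _ hab
      have : (a : ℝ) ≤ b := by exact_mod_cast hab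
      simp only [hu_def]
      gcongr
    have h0 : u 0 = 0 := by simp [hu_def]
    have h1 : u (N + 1) = 1 := by
      simp only [hu_def]; push_cast; exact div_self hN0.ne'
    calc edist (Φ (γ 0)) (Φ (γ 1))
        = edist (Φ (γ (u 0))) (Φ (γ (u (N + 1)))) := by rw [h0, h1]
      _ ≤ ∑ i ∈ Finset.range (N + 1), edist (Φ (γ (u i))) (Φ (γ (u (i + 1)))) :=
          edist_le_range_sum_edist (fun i => Φ (γ (u i))) (N + 1)
      _ ≤ ∑ i ∈ Finset.range (N + 1),
            ENNReal.ofReal (1 + δ) * edist (γ (u (i + 1))) (γ (u i)) := by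
          refine Finset.sum_le_sum fun i hi => ?_
          have hi' : i < N + 1 := Finset.mem_range.1 hi
          have m0 := humem i (show i ≤ N + 1 by omega)
          have m1 := humem (i + 1) (show i + 1 ≤ N + 1 by omega)
          have hd : dist (u i) (u (i + 1)) < θ := by
            have e : u i - u (i + 1) = -(1 / ((N : ℝ) + 1)) := by
              simp only [hu_def]; push_cast; ring
            rw [Real.dist_eq, e, abs_neg, abs_of_pos (by positivity)]
            exact hN
          have := H _ (hmaps m0) _ (hmaps m1) (hu _ m0 _ m1 hd)
          rw [edist_comm (γ (u (i + 1))), edist_dist, edist_dist,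
            ← ENNReal.ofReal_mul (by positivity)]
          exact ENNReal.ofReal_le_ofReal this
      _ = ENNReal.ofReal (1 + δ) *
            ∑ i ∈ Finset.range (N + 1), edist (γ (u (i + 1))) (γ (u i)) :=
          (Finset.mul_sum _ _ _).symm
      _ ≤ ENNReal.ofReal (1 + δ) * eVariationOn γ (Icc 0 1) := by
          gcongr
          exact eVariationOn.sum_le_of_monotoneOn_Iic hmono humem
  lift eVariationOn γ (Icc 0 1) to NNReal using hL with l
  have hreal : ∀ δ : ℝ, 0 < δ → dist (Φ (γ 0)) (Φ (γ 1)) ≤ (1 + δ) * l := by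
    intro δ hδ
    have := key δ hδ
    rw [edist_dist, ← ENNReal.ofReal_coe_nnreal, ← ENNReal.ofReal_mul (by positivity)] at this
    exact (ENNReal.ofReal_le_ofReal_iff (by positivity)).1 this
  rw [edist_dist, ← ENNReal.ofReal_coe_nnreal]
  refine ENNReal.ofReal_le_ofReal (le_of_forall_pos_le_add fun e he => ?_)
  have hl : (0 : ℝ) ≤ l := l.2
  refine (hreal (e / (l + 1)) (by positivity)).trans ?_
  have : e / (l + 1) * l ≤ e := by
    rw [div_mul_eq_mul_div, div_le_iff₀ (by positivity)]
    nlinarith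
  linarith

theorem hasDerivAt_max_zero_pow_three (x : ℝ) :
    HasDerivAt (fun x : ℝ => max x 0 ^ 3) (3 * max x 0 ^ 2) x := by
  rcases lt_trichotomy x 0 with hx | rfl | hx
  · have e : (fun x : ℝ => max x 0 ^ 3) =ᶠ[nhds x] fun _ => 0 := by
      filter_upwards [gt_mem_nhds hx] with y hy
      simp [max_eq_right (le_of_lt hy)]
    rw [max_eq_right hx.le]
    simpa using (hasDerivAt_const x (0 : ℝ)).congr_of_eventuallyEq e
  · rw [hasDerivAt_iff_isLittleO]
    simp only [max_self, ne_eq, OfNat.ofNat_ne_zero, not_false_eq_true, zero_pow, mul_zero,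
      smul_zero, sub_zero]
    have h1 : (fun x : ℝ => max x 0 ^ 3) =O[nhds 0] fun x : ℝ => x ^ 3 := by
      refine Asymptotics.IsBigO.of_bound 1 (Filter.Eventually.of_forall fun y => ?_)
      rw [one_mul, norm_pow, norm_pow, Real.norm_eq_abs, Real.norm_eq_abs]
      gcongr 1
      rw [abs_of_nonneg (le_max_right _ _)]
      exact max_le (le_abs_self y) (abs_nonneg y)
    have h2 : (fun x : ℝ => x ^ 3) =o[nhds 0] fun x : ℝ => x := by
      simpa using Asymptotics.isLittleO_pow_id (𝕜 := ℝ) (n := 3) (by norm_num)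
    exact h1.trans_isLittleO h2
  · have e : (fun x : ℝ => max x 0 ^ 3) =ᶠ[nhds x] fun x => x ^ 3 := by
      filter_upwards [lt_mem_nhds hx] with y hy
      rw [max_eq_left (le_of_lt hy)]
    rw [max_eq_left hx.le]
    simpa using (hasDerivAt_pow 3 x).congr_of_eventuallyEq e

theorem hasDerivAt_abs_pow_three (x : ℝ) :
    HasDerivAt (fun x : ℝ => |x| ^ 3) (3 * max x 0 ^ 2 - 3 * max (-x) 0 ^ 2) x := by
  have e : (fun x : ℝ => |x| ^ 3) = fun x => max x 0 ^ 3 + max (-x) 0 ^ 3 := by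
    funext y
    rcases le_total 0 y with hy | hy
    · simp [abs_of_nonneg hy, max_eq_left hy, max_eq_right (neg_nonpos.2 hy)]
    · simp [abs_of_nonpos hy, max_eq_right hy, max_eq_left (neg_nonneg.2 hy)]
  rw [e]
  refine ((hasDerivAt_max_zero_pow_three x).add
    ((hasDerivAt_max_zero_pow_three (-x)).comp x (hasDerivAt_neg x))).congr_deriv ?_
  ring

theorem hasDerivAt_triCube_explicit (x : ℝ) :
    HasDerivAt triCube
      (3 * max (1 - |x| ^ 3) 0 ^ 2 * -(3 * max x 0 ^ 2 - 3 * max (-x) 0 ^ 2)) x :=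
  HasDerivAt.comp (h₂ := fun y : ℝ => max y 0 ^ 3) x
    (hasDerivAt_max_zero_pow_three (1 - |x| ^ 3))
    ((hasDerivAt_abs_pow_three x).const_sub 1)

theorem deriv_triCube (x : ℝ) : deriv triCube x =
    3 * max (1 - |x| ^ 3) 0 ^ 2 * -(3 * max x 0 ^ 2 - 3 * max (-x) 0 ^ 2) :=
  (hasDerivAt_triCube_explicit x).deriv

theorem hasDerivAt_triCube (x : ℝ) : HasDerivAt triCube (deriv triCube x) x :=
  (hasDerivAt_triCube_explicit x).differentiableAt.hasDerivAt

theorem continuous_deriv_triCube : Continuous (deriv triCube) := by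
  rw [funext deriv_triCube]
  fun_prop

theorem max_one_sub_abs_pow_three_eq_zero {x : ℝ} (hx : 1 ≤ |x|) : max (1 - |x| ^ 3) 0 = 0 :=
  max_eq_right (sub_nonpos.2 (one_le_pow₀ hx))

theorem triCube_eq_zero {x : ℝ} (hx : 1 ≤ |x|) : triCube x = 0 := by
  simp [triCube, max_one_sub_abs_pow_three_eq_zero hx]

theorem deriv_triCube_eq_zero {x : ℝ} (hx : 1 ≤ |x|) : deriv triCube x = 0 := by
  simp [deriv_triCube, max_one_sub_abs_pow_three_eq_zero hx]

theorem hasDerivAt_bumpTrain (A ε : ℝ) (m : ℕ) (t : ℝ) :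
    HasDerivAt (bumpTrain A ε m) (A * (ε / 2) ^ 2 * ∑ i ∈ Finset.range (m - 1),
      deriv triCube ((t - ((i : ℝ) + 1 / 2) * ε) / (ε / 2)) * (1 / (ε / 2))) t := by
  refine HasDerivAt.const_mul _ (HasDerivAt.fun_sum fun i _ => ?_)
  exact (hasDerivAt_triCube _).comp t (((hasDerivAt_id t).sub_const _).div_const _)

theorem continuous_deriv_bumpTrain (A ε : ℝ) (m : ℕ) : Continuous (deriv (bumpTrain A ε m)) := by
  rw [funext fun t => (hasDerivAt_bumpTrain A ε m t).deriv]
  have := continuous_deriv_triCube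
  fun_prop

theorem one_le_abs_bump_arg {ε : ℝ} (hε : 0 < ε) {p i : ℕ} (hpi : i ≠ p) {t : ℝ}
    (ht : t ∈ Icc ((p : ℝ) * ε) (((p : ℝ) + 1) * ε)) :
    1 ≤ |(t - ((i : ℝ) + 1 / 2) * ε) / (ε / 2)| := by
  rw [abs_div, abs_of_pos (half_pos hε), le_div_iff₀ (half_pos hε), one_mul]
  rcases lt_or_gt_of_ne hpi with h | h
  · have : (i : ℝ) + 1 ≤ p := by exact_mod_cast h
    refine le_trans ?_ (le_abs_self _)
    nlinarith [ht.1]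
  · have : (p : ℝ) + 1 ≤ i := by exact_mod_cast h
    refine le_trans ?_ (neg_le_abs _)
    nlinarith [ht.2]

theorem bumpTrain_nat_mul {A ε : ℝ} (hε : 0 < ε) (m p : ℕ) : bumpTrain A ε m (p * ε) = 0 := by
  unfold bumpTrain
  rw [Finset.sum_eq_zero, mul_zero]
  intro i _
  apply triCube_eq_zero
  rcases eq_or_ne i p with rfl | h
  · rw [show ((i : ℝ) * ε - ((i : ℝ) + 1 / 2) * ε) / (ε / 2) = -1 by field_simp; ring]
    simp
  · exact one_le_abs_bump_arg hε h ⟨le_rfl, by nlinarith⟩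

theorem deriv_bumpTrain_eq {A ε : ℝ} (hε : 0 < ε) {m p : ℕ} (hp : p < m - 1) {t : ℝ}
    (ht : t ∈ Icc ((p : ℝ) * ε) (((p : ℝ) + 1) * ε)) :
    deriv (bumpTrain A ε m) t =
      A * ε / 2 * deriv triCube (t / (ε / 2) - (2 * p + 1)) := by
  rw [(hasDerivAt_bumpTrain A ε m t).deriv, Finset.sum_eq_single p]
  · rw [show (t - ((p : ℝ) + 1 / 2) * ε) / (ε / 2) = t / (ε / 2) - (2 * p + 1) by
      field_simp]
    field_simp
  · intro i _ hi
    rw [deriv_triCube_eq_zero (one_le_abs_bump_arg hε hi ht), zero_mul]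
  · intro h
    exact absurd (Finset.mem_range.2 hp) h

theorem one_add_half_sub_le_sqrt {x : ℝ} (hx : 0 ≤ x) :
    1 + x / 2 - x ^ 2 / 8 ≤ √(1 + x) := by
  rcases le_total x 8 with h | h
  · refine Real.le_sqrt_of_sq_le ?_
    nlinarith [mul_nonneg (pow_nonneg hx 3) (sub_nonneg.2 h)]
  · exact le_trans (by nlinarith) (Real.sqrt_nonneg _)

theorem continuous_sqrt_one_add_deriv_bumpTrain_sq (A ε : ℝ) (m : ℕ) :
    Continuous fun t => √(1 + deriv (bumpTrain A ε m) t ^ 2) := by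
  have := continuous_deriv_bumpTrain A ε m
  fun_prop

/-- The arc length of one bump is at least `ε (1 + C₁ε²/2)`. -/
theorem le_integral_period {A ε C₁ C₂ : ℝ} (hε : 0 < ε) {m p : ℕ} (hp : p < m - 1)
    (hC₁ : C₁ = A ^ 2 / 16 * ∫ t in (-1 : ℝ)..1, (deriv triCube t) ^ 2)
    (hC₂ : C₂ = A ^ 4 / 256 * ∫ t in (-1 : ℝ)..1, (deriv triCube t) ^ 4)
    (hsmall : C₂ * ε ^ 2 ≤ C₁ / 2) :
    ε * (1 + C₁ * ε ^ 2 / 2) ≤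
      ∫ t in ((p : ℝ) * ε)..(((p : ℝ) + 1) * ε), √(1 + deriv (bumpTrain A ε m) t ^ 2) := by
  have hc := continuous_deriv_triCube
  set F : ℝ → ℝ := fun u =>
    1 + A ^ 2 * ε ^ 2 / 8 * deriv triCube u ^ 2 - A ^ 4 * ε ^ 4 / 128 * deriv triCube u ^ 4
    with hF
  have hFc : Continuous F := by fun_prop
  have hval : ∫ t in ((p : ℝ) * ε)..(((p : ℝ) + 1) * ε), F (t / (ε / 2) - (2 * p + 1)) =
      ε * (1 + C₁ * ε ^ 2 - C₂ * ε ^ 4) := by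
    rw [intervalIntegral.integral_comp_div_sub F (half_pos hε).ne']
    rw [show (p : ℝ) * ε / (ε / 2) - (2 * p + 1) = -1 by field_simp; ring,
      show ((p : ℝ) + 1) * ε / (ε / 2) - (2 * p + 1) = 1 by field_simp; ring, hF,
      intervalIntegral.integral_sub, intervalIntegral.integral_add,
      intervalIntegral.integral_const_mul, intervalIntegral.integral_const_mul,
      intervalIntegral.integral_const, hC₁, hC₂]
    · simp only [smul_eq_mul]; ring
    all_goals exact Continuous.intervalIntegrable (by fun_prop) _ _
  have hle : ∫ t in ((p : ℝ) * ε)..(((p : ℝ) + 1) * ε), F (t / (ε / 2) - (2 * p + 1)) ≤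
      ∫ t in ((p : ℝ) * ε)..(((p : ℝ) + 1) * ε), √(1 + deriv (bumpTrain A ε m) t ^ 2) := by
    refine intervalIntegral.integral_mono_on (by nlinarith)
      (Continuous.intervalIntegrable (by fun_prop) _ _)
      ((continuous_sqrt_one_add_deriv_bumpTrain_sq A ε m).intervalIntegrable _ _) fun t ht => ?_
    rw [deriv_bumpTrain_eq hε hp ht]
    refine le_trans (le_of_eq ?_) (one_add_half_sub_le_sqrt (sq_nonneg _))
    simp only [hF]
    ring
  refine le_trans ?_ (hval ▸ hle)
  gcongr
  nlinarith [mul_le_mul_of_nonneg_right hsmall (sq_nonneg ε)]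

/-- Arc length along the graph of the bump train, measured from `0`. -/
noncomputable def bumpArcLength (A ε : ℝ) (m : ℕ) (t : ℝ) : ℝ :=
  ∫ s in (0 : ℝ)..t, √(1 + deriv (bumpTrain A ε m) s ^ 2)

theorem hasDerivAt_bumpArcLength (A ε : ℝ) (m : ℕ) (t : ℝ) :
    HasDerivAt (bumpArcLength A ε m) (√(1 + deriv (bumpTrain A ε m) t ^ 2)) t :=
  (continuous_sqrt_one_add_deriv_bumpTrain_sq A ε m).integral_hasStrictDerivAt 0 t |>.hasDerivAt

theorem le_bumpArcLength_sub {A ε C₁ C₂ : ℝ} (hε : 0 < ε) {m : ℕ}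
    (hC₁ : C₁ = A ^ 2 / 16 * ∫ t in (-1 : ℝ)..1, (deriv triCube t) ^ 2)
    (hC₂ : C₂ = A ^ 4 / 256 * ∫ t in (-1 : ℝ)..1, (deriv triCube t) ^ 4)
    (hsmall : C₂ * ε ^ 2 ≤ C₁ / 2) (p : ℕ) {q : ℕ} (hpq : p ≤ q) (hq : q ≤ m - 1) :
    ((q : ℝ) - p) * (ε * (1 + C₁ * ε ^ 2 / 2)) ≤
      bumpArcLength A ε m (q * ε) - bumpArcLength A ε m (p * ε) := by
  induction q, hpq using Nat.le_induction with
  | base => simp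
  | succ q hpq ih =>
    have h1 := ih (by omega)
    have h2 := le_integral_period hε (show q < m - 1 by omega) hC₁ hC₂ hsmall
    have hi := (continuous_sqrt_one_add_deriv_bumpTrain_sq A ε m).intervalIntegrable
      (μ := MeasureTheory.volume)
    rw [← intervalIntegral.integral_interval_sub_left (hi 0 _) (hi 0 _)] at h2
    push_cast
    unfold bumpArcLength at *
    linarith

theorem le_abs_bumpArcLength_sub {A ε C₁ C₂ : ℝ} (hε : 0 < ε) {m : ℕ}
    (hC₁ : C₁ = A ^ 2 / 16 * ∫ t in (-1 : ℝ)..1, (deriv triCube t) ^ 2)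
    (hC₂ : C₂ = A ^ 4 / 256 * ∫ t in (-1 : ℝ)..1, (deriv triCube t) ^ 4)
    (hsmall : C₂ * ε ^ 2 ≤ C₁ / 2) {p q : ℕ} (hp : p ≤ m - 1) (hq : q ≤ m - 1) :
    |(p : ℝ) - q| * (ε * (1 + C₁ * ε ^ 2 / 2)) ≤
      |bumpArcLength A ε m (p * ε) - bumpArcLength A ε m (q * ε)| := by
  rcases le_total p q with h | h
  · have : (p : ℝ) ≤ q := by exact_mod_cast h
    rw [abs_of_nonpos (sub_nonpos.2 this), neg_sub, abs_sub_comm]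
    exact (le_bumpArcLength_sub hε hC₁ hC₂ hsmall p h hq).trans (le_abs_self _)
  · have : (q : ℝ) ≤ p := by exact_mod_cast h
    rw [abs_of_nonneg (sub_nonneg.2 this)]
    exact (le_bumpArcLength_sub hε hC₁ hC₂ hsmall q h hp).trans (le_abs_self _)

/-- At small scales, arc length exceeds chord length by at most a factor `1 + δ`. -/
theorem exists_bumpArcLength_le (A ε : ℝ) (m : ℕ) {δ : ℝ} (hδ : 0 < δ) :
    ∃ η > 0, ∀ u ∈ Icc (0 : ℝ) 1, ∀ v ∈ Icc (0 : ℝ) 1, |u - v| < η →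
      (bumpArcLength A ε m u - bumpArcLength A ε m v) ^ 2 ≤ (1 + δ) ^ 2 *
        ((u - v) ^ 2 + (bumpTrain A ε m u - bumpTrain A ε m v) ^ 2) := by
  obtain ⟨η, hη, H⟩ := Metric.uniformContinuousOn_iff.1
    (isCompact_Icc.uniformContinuousOn_of_continuous
      (continuous_sqrt_one_add_deriv_bumpTrain_sq A ε m).continuousOn (s := Icc (0 : ℝ) 1)) δ hδ
  have key : ∀ u ∈ Icc (0 : ℝ) 1, ∀ v ∈ Icc (0 : ℝ) 1, u < v → |u - v| < η →
      (bumpArcLength A ε m u - bumpArcLength A ε m v) ^ 2 ≤ (1 + δ) ^ 2 *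
        ((u - v) ^ 2 + (bumpTrain A ε m u - bumpTrain A ε m v) ^ 2) := by
    intro u hu v hv huv hlt
    have hg : ∀ x, HasDerivAt (bumpTrain A ε m) (deriv (bumpTrain A ε m) x) x := fun x =>
      (hasDerivAt_bumpTrain A ε m x).differentiableAt.hasDerivAt
    obtain ⟨ξ, hξ, hξe⟩ := exists_hasDerivAt_eq_slope (bumpArcLength A ε m) _ huv
      (fun x _ => (hasDerivAt_bumpArcLength A ε m x).continuousAt.continuousWithinAt)
      (fun x _ => hasDerivAt_bumpArcLength A ε m x)
    obtain ⟨ζ, hζ, hζe⟩ := exists_hasDerivAt_eq_slope (bumpTrain A ε m) _ huv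
      (fun x _ => (hg x).continuousAt.continuousWithinAt) (fun x _ => hg x)
    have hvu : 0 < v - u := sub_pos.2 huv
    rw [eq_div_iff hvu.ne'] at hξe hζe
    have hlt' : v - u < η := by rwa [abs_sub_comm, abs_of_pos hvu] at hlt
    have hdist := H ξ ⟨hu.1.trans hξ.1.le, hξ.2.le.trans hv.2⟩ ζ
      ⟨hu.1.trans hζ.1.le, hζ.2.le.trans hv.2⟩ (by
        rw [Real.dist_eq, abs_lt]
        constructor <;> linarith [hξ.1, hξ.2, hζ.1, hζ.2])
    rw [Real.dist_eq] at hdist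
    have h1 : 1 ≤ √(1 + deriv (bumpTrain A ε m) ζ ^ 2) :=
      Real.one_le_sqrt.2 (by nlinarith [sq_nonneg (deriv (bumpTrain A ε m) ζ)])
    have h2 : √(1 + deriv (bumpTrain A ε m) ξ ^ 2) ≤
        (1 + δ) * √(1 + deriv (bumpTrain A ε m) ζ ^ 2) := by
      nlinarith [(abs_lt.1 hdist).2]
    have h3 := pow_le_pow_left₀ (Real.sqrt_nonneg _) h2 2
    rw [mul_pow, Real.sq_sqrt (by positivity), Real.sq_sqrt (by positivity)] at h3
    have h4 := mul_le_mul_of_nonneg_right h3 (sq_nonneg (v - u))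
    have e1 : (bumpArcLength A ε m u - bumpArcLength A ε m v) ^ 2 =
        (1 + deriv (bumpTrain A ε m) ξ ^ 2) * (v - u) ^ 2 := by
      rw [← neg_sub, neg_sq, ← hξe, mul_pow, Real.sq_sqrt (by positivity)]
    have e2 : (bumpTrain A ε m u - bumpTrain A ε m v) ^ 2 =
        deriv (bumpTrain A ε m) ζ ^ 2 * (v - u) ^ 2 := by
      rw [← neg_sub, neg_sq, ← hζe, mul_pow]
    rw [e1, e2]
    linarith
  refine ⟨η, hη, fun u hu v hv hlt => ?_⟩
  rcases lt_trichotomy u v with h | rfl | h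
  · exact key u hu v hv h hlt
  · simp
  · have := key v hv u hu h (by rwa [abs_sub_comm])
    rw [← neg_sub (bumpArcLength A ε m v), ← neg_sub v, ← neg_sub (bumpTrain A ε m v)]
    simpa only [neg_sq] using this

theorem contDiff_bumpTrain (A ε : ℝ) (m : ℕ) : ContDiff ℝ 1 (bumpTrain A ε m) :=
  contDiff_one_iff_deriv.2 ⟨fun t => (hasDerivAt_bumpTrain A ε m t).differentiableAt,
    continuous_deriv_bumpTrain A ε m⟩

@[simp]
theorem embGraph_castSucc {k : ℕ} (t : Fin k → ℝ) (z : ℝ) (q : Fin k) :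
    embGraph t z q.castSucc = t q := by
  simp [embGraph]

@[simp]
theorem embGraph_last {k : ℕ} (t : Fin k → ℝ) (z : ℝ) : embGraph t z (Fin.last k) = z := by
  simp [embGraph]

theorem dist_embGraph_sq {k : ℕ} (t t' : Fin k → ℝ) (z z' : ℝ) :
    dist (embGraph t z) (embGraph t' z') ^ 2 = (∑ q, (t q - t' q) ^ 2) + (z - z') ^ 2 := by
  rw [EuclideanSpace.dist_eq, Real.sq_sqrt (by positivity), Fin.sum_univ_castSucc]
  simp [Real.dist_eq, sq_abs]

theorem intrinsicDist_eq_edist_of_convex {E : Type*} [NormedAddCommGroup E] [NormedSpace ℝ E]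
    {A : Set E} (hA : Convex ℝ A) {x x' : E} (hx : x ∈ A) (hx' : x' ∈ A) :
    intrinsicDist A x x' = edist x x' := by
  apply le_antisymm
  · have hlip := lipschitzWith_lineMap (𝕜 := ℝ) x x'
    have hmem : MapsTo (AffineMap.lineMap x x' : ℝ → E) (Icc 0 1) A := fun t ht =>
      hA.lineMap_mem hx hx' ht
    have h0 : intrinsicDist A x x' ≤ eVariationOn (AffineMap.lineMap x x' : ℝ → E) (Icc 0 1) :=
      sInf_le ⟨AffineMap.lineMap x x', hlip.continuous.continuousOn, hmem,
        AffineMap.lineMap_apply_zero _ _, AffineMap.lineMap_apply_one _ _, rfl⟩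
    have h1 := (hlip.lipschitzOnWith (s := univ)).comp_eVariationOn_le
      (g := (id : ℝ → ℝ)) (s := Icc 0 1) (mapsTo_univ _ _)
    have h2 : eVariationOn (id : ℝ → ℝ) (Icc 0 1) ≤ 1 := by simp
    rw [Function.comp_id] at h1
    calc intrinsicDist A x x' ≤ _ := h0.trans h1
      _ ≤ (nndist x x' : ℝ≥0∞) * 1 := by gcongr
      _ = edist x x' := by rw [mul_one, edist_nndist]
  · exact edist_le_intrinsicDist (Φ := id)
      (fun δ hδ => ⟨1, one_pos, fun p _ p' _ _ =>
        le_mul_of_one_le_left dist_nonneg (by linarith)⟩) x x'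

theorem convex_flat_cube (k : ℕ) :
    Convex ℝ {p : EuclideanSpace ℝ (Fin (k + 1)) |
      ∃ t : Fin k → ℝ, (∀ q, t q ∈ Icc (0 : ℝ) 1) ∧ p = embGraph t 0} := by
  rintro _ ⟨t, ht, rfl⟩ _ ⟨t', ht', rfl⟩ a b ha hb hab
  refine ⟨fun q => a * t q + b * t' q, fun q => ?_, ?_⟩
  · exact convex_Icc (0 : ℝ) 1 (ht q) (ht' q) ha hb hab
  · ext q
    refine Fin.lastCases ?_ (fun q => ?_) q <;> simp

/-- A continuously differentiable graph over the cube has finite intrinsic distances. -/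
theorem intrinsicDist_graph_ne_top {n : ℕ} {g : ℝ → ℝ} (hg : ContDiff ℝ 1 g)
    {t t' : Fin (n + 1) → ℝ} (ht : ∀ q, t q ∈ Icc (0 : ℝ) 1) (ht' : ∀ q, t' q ∈ Icc (0 : ℝ) 1) :
    intrinsicDist {p | ∃ t : Fin (n + 1) → ℝ, (∀ q, t q ∈ Icc (0 : ℝ) 1) ∧
      p = embGraph t (g (t (Fin.last n)))}
      (embGraph t (g (t (Fin.last n)))) (embGraph t' (g (t' (Fin.last n)))) ≠ ⊤ := by
  set c : ℝ → Fin (n + 1) → ℝ := fun s q => (1 - s) * t q + s * t' q with hc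
  set γ : ℝ → EuclideanSpace ℝ (Fin (n + 1 + 1)) := fun s =>
    embGraph (c s) (g (c s (Fin.last n))) with hγ
  have hγd : ContDiff ℝ 1 γ := by
    refine contDiff_euclidean.2 fun q => ?_
    refine Fin.lastCases ?_ (fun q => ?_) q
    · simp only [hγ, embGraph_last, hc]
      fun_prop
    · simp only [hγ, embGraph_castSucc, hc]
      fun_prop
  obtain ⟨K, hK⟩ := LocallyLipschitzOn.exists_lipschitzOnWith_of_compact
    (isCompact_Icc (a := (0 : ℝ)) (b := 1)) hγd.locallyLipschitz.locallyLipschitzOn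
  have hfin := hK.locallyBoundedVariationOn 0 1 (left_mem_Icc.2 zero_le_one)
    (right_mem_Icc.2 zero_le_one)
  rw [inter_self] at hfin
  refine ne_top_of_le_ne_top hfin (sInf_le ⟨γ, hγd.continuous.continuousOn, ?_, ?_, ?_, rfl⟩)
  · intro s hs
    refine ⟨c s, fun q => ?_, rfl⟩
    exact convex_Icc (0 : ℝ) 1 (ht q) (ht' q) (sub_nonneg.2 hs.2) hs.1 (sub_add_cancel _ _)
  · simp [hγ, hc]
  · simp [hγ, hc]

/-- The graph of the bump train is no shorter than its flat unrolling by arc length. -/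
theorem edist_unroll_le_intrinsicDist (A ε : ℝ) (m n : ℕ) (t t' : Fin (n + 1) → ℝ) (z z' : ℝ) :
    edist (embGraph (fun q : Fin n => t q.castSucc) (bumpArcLength A ε m (t (Fin.last n))))
      (embGraph (fun q : Fin n => t' q.castSucc) (bumpArcLength A ε m (t' (Fin.last n)))) ≤
    intrinsicDist {p | ∃ t : Fin (n + 1) → ℝ, (∀ q, t q ∈ Icc (0 : ℝ) 1) ∧
      p = embGraph t (bumpTrain A ε m (t (Fin.last n)))} (embGraph t z) (embGraph t' z') := by
  have := edist_le_intrinsicDist (A := {p | ∃ t : Fin (n + 1) → ℝ, (∀ q, t q ∈ Icc (0 : ℝ) 1) ∧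
      p = embGraph t (bumpTrain A ε m (t (Fin.last n)))})
    (Φ := fun p : EuclideanSpace ℝ (Fin (n + 1 + 1)) =>
      embGraph (fun q : Fin n => p q.castSucc.castSucc)
        (bumpArcLength A ε m (p (Fin.last n).castSucc))) ?_ (embGraph t z) (embGraph t' z')
  · simpa only [embGraph_castSucc] using this
  intro δ hδ
  obtain ⟨η, hη, H⟩ := exists_bumpArcLength_le A ε m hδ
  refine ⟨η, hη, ?_⟩
  rintro _ ⟨u, hu, rfl⟩ _ ⟨v, hv, rfl⟩ hd
  have hsplit := dist_embGraph_sq u v (bumpTrain A ε m (u (Fin.last n)))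
    (bumpTrain A ε m (v (Fin.last n)))
  rw [Fin.sum_univ_castSucc] at hsplit
  have hnn : 0 ≤ ∑ q : Fin n, (u q.castSucc - v q.castSucc) ^ 2 := by positivity
  have hlast : |u (Fin.last n) - v (Fin.last n)| < η := by
    refine lt_of_le_of_lt (abs_le_of_sq_le_sq ?_ dist_nonneg) hd
    nlinarith [sq_nonneg (bumpTrain A ε m (u (Fin.last n)) - bumpTrain A ε m (v (Fin.last n)))]
  have hS := H _ (hu _) _ (hv _) hlast
  simp only [embGraph_castSucc]
  refine le_of_sq_le_sq ?_ (by positivity)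
  rw [mul_pow, dist_embGraph_sq, hsplit]
  have : (1 : ℝ) ≤ (1 + δ) ^ 2 := one_le_pow₀ (by linarith)
  nlinarith

/-- Stretching one leg of a right triangle by `1 + s / 2` lengthens the hypotenuse `D` by at least
`s / 3 * β ^ 2 * D`, where `β` is the cosine of the angle at that leg. -/
theorem mul_sq_mul_le_sub_of_sq_le {P N ε s D d β : ℝ} (hP : 0 ≤ P) (hD : 0 ≤ D) (hd : 0 ≤ d)
    (hs0 : 0 ≤ s) (hs1 : s ≤ 1) (hD_sq : D ^ 2 = P + N ^ 2 * ε ^ 2)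
    (hd_sq : P + N ^ 2 * (ε * (1 + s / 2)) ^ 2 ≤ d ^ 2) (hβ : β = |N| * ε / D) :
    s / 3 * β ^ 2 * D ≤ d - D := by
  rcases hD.eq_or_lt with rfl | hD'
  · simpa using hd
  have hb : β ^ 2 * D ^ 2 = N ^ 2 * ε ^ 2 := by
    rw [← mul_pow, hβ, div_mul_cancel₀ _ hD'.ne', mul_pow, sq_abs]
  have hkey : D ^ 2 * (1 + s * β ^ 2) ≤ d ^ 2 := by
    have h : 0 ≤ N ^ 2 * ε ^ 2 * s ^ 2 := by positivity
    calc D ^ 2 * (1 + s * β ^ 2) = D ^ 2 + s * (β ^ 2 * D ^ 2) := by ring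
      _ = P + N ^ 2 * ε ^ 2 * (1 + s) := by rw [hb, hD_sq]; ring
      _ ≤ P + N ^ 2 * (ε * (1 + s / 2)) ^ 2 := by linarith
      _ ≤ d ^ 2 := hd_sq
  have hβ1 : β ^ 2 ≤ 1 := by
    have : β ^ 2 * D ^ 2 ≤ 1 * D ^ 2 := by linarith
    exact le_of_mul_le_mul_right this (by positivity)
  have hy0 : 0 ≤ s * β ^ 2 := by positivity
  have hy1 : s * β ^ 2 ≤ 1 := mul_le_one₀ hs1 (sq_nonneg _) hβ1
  have hfin : D * (1 + s * β ^ 2 / 3) ≤ d := by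
    refine le_of_sq_le_sq (le_trans ?_ hkey) hd
    rw [mul_pow]
    gcongr
    nlinarith
  linarith

/-- In the `k`-dimensional grid setting, if `C₂ε² ≤ C₁/2` and `C₁ε² ≤ 1`,
then for all `i ≠ j`,
`d_{M₂}(x_i,x_j) − d_{M₁}(x_i,x_j) ≥ (C₁/3)ε²·β_{ij}²·d_{M₁}(x_i,x_j)`, where
`β_{ij} = |i_k − j_k|·ε / d_{M₁}(x_i,x_j)` is the cosine of the angle the segment `[x_i, x_j]`
makes with the `k`-th coordinate axis. -/
theorem grid_minimax_separation (A : ℝ) (hA : 0 < A) (k m : ℕ) (hk : 2 ≤ k) (hm : 2 ≤ m)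
    (ε : ℝ) (hε : ε = 1 / ((m : ℝ) - 1))
    (M₁ M₂ : Set (EuclideanSpace ℝ (Fin (k + 1))))
    (hM₁ : M₁ = {p | ∃ t : Fin k → ℝ, (∀ q, t q ∈ Icc (0 : ℝ) 1) ∧ p = embGraph t 0})
    (hM₂ : M₂ = {p | ∃ t : Fin k → ℝ, (∀ q, t q ∈ Icc (0 : ℝ) 1) ∧
      p = embGraph t (bumpTrain A ε m (t ⟨k - 1, by omega⟩))})
    (x : (Fin k → Fin m) → EuclideanSpace ℝ (Fin (k + 1)))
    (hx : ∀ i, x i = embGraph (fun q => ((i q : ℕ) : ℝ) * ε) 0)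
    (C₁ : ℝ) (hC₁ : C₁ = A ^ 2 / 16 * ∫ t in (-1 : ℝ)..1, (deriv triCube t) ^ 2)
    (C₂ : ℝ) (hC₂ : C₂ = A ^ 4 / 256 * ∫ t in (-1 : ℝ)..1, (deriv triCube t) ^ 4)
    (hsmall₁ : C₂ * ε ^ 2 ≤ C₁ / 2) (hsmall₂ : C₁ * ε ^ 2 ≤ 1)
    (i j : Fin k → Fin m) (hij : i ≠ j)
    (β : ℝ)
    (hβ : β = |((i ⟨k - 1, by omega⟩ : ℕ) : ℝ) - ((j ⟨k - 1, by omega⟩ : ℕ) : ℝ)| * ε /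
      (intrinsicDist M₁ (x i) (x j)).toReal) :
    C₁ / 3 * ε ^ 2 * β ^ 2 * (intrinsicDist M₁ (x i) (x j)).toReal ≤
      (intrinsicDist M₂ (x i) (x j)).toReal - (intrinsicDist M₁ (x i) (x j)).toReal := by
  obtain ⟨n, rfl⟩ : ∃ n, k = n + 1 := ⟨k - 1, by omega⟩
  change β = |((i (Fin.last n) : ℕ) : ℝ) - ((j (Fin.last n) : ℕ) : ℝ)| * ε / _ at hβ
  change M₂ = {p | ∃ t : Fin (n + 1) → ℝ, (∀ q, t q ∈ Icc (0 : ℝ) 1) ∧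
      p = embGraph t (bumpTrain A ε m (t (Fin.last n)))} at hM₂
  have hm1 : (0 : ℝ) < (m : ℝ) - 1 := by
    have : (2 : ℝ) ≤ m := by exact_mod_cast hm
    linarith
  have hε0 : 0 < ε := by rw [hε]; positivity
  have hgrid : ∀ (l : Fin (n + 1) → Fin m) q, ((l q : ℕ) : ℝ) * ε ∈ Icc (0 : ℝ) 1 := by
    intro l q
    refine ⟨by positivity, ?_⟩
    have : ((l q : ℕ) : ℝ) + 1 ≤ m := by exact_mod_cast (l q).2
    rw [hε, mul_one_div, div_le_one hm1]
    linarith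
  have hd₁ : intrinsicDist M₁ (x i) (x j) = edist (x i) (x j) := by
    rw [hM₁]
    exact intrinsicDist_eq_edist_of_convex (convex_flat_cube (n + 1))
      ⟨_, hgrid i, hx i⟩ ⟨_, hgrid j, hx j⟩
  have hd₁' : (intrinsicDist M₁ (x i) (x j)).toReal = dist (x i) (x j) := by
    rw [hd₁, dist_edist]
  have htop : intrinsicDist M₂ (x i) (x j) ≠ ⊤ := by
    have := intrinsicDist_graph_ne_top (contDiff_bumpTrain A ε m) (hgrid i) (hgrid j)
    rwa [bumpTrain_nat_mul hε0, bumpTrain_nat_mul hε0, ← hx, ← hx, ← hM₂] at this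
  have hlow := edist_unroll_le_intrinsicDist A ε m n (fun q => ((i q : ℕ) : ℝ) * ε)
    (fun q => ((j q : ℕ) : ℝ) * ε) 0 0
  rw [← hx, ← hx, ← hM₂] at hlow
  have hlow' := ENNReal.toReal_mono htop hlow
  rw [← dist_edist] at hlow'
  have hlow_sq := pow_le_pow_left₀ dist_nonneg hlow' 2
  rw [dist_embGraph_sq] at hlow_sq
  have hD_sq := dist_embGraph_sq (fun q => ((i q : ℕ) : ℝ) * ε) (fun q => ((j q : ℕ) : ℝ) * ε) 0 0
  rw [← hx, ← hx, Fin.sum_univ_castSucc] at hD_sq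
  have harc := le_abs_bumpArcLength_sub hε0 hC₁ hC₂ hsmall₁
    (show (i (Fin.last n) : ℕ) ≤ m - 1 by omega) (show (j (Fin.last n) : ℕ) ≤ m - 1 by omega)
  have hC₁0 : 0 ≤ C₁ := by
    rw [hC₁]
    exact mul_nonneg (by positivity)
      (intervalIntegral.integral_nonneg (by norm_num) fun _ _ => sq_nonneg _)
  have harc_sq := pow_le_pow_left₀ (by positivity) harc 2
  rw [sq_abs, mul_pow, sq_abs] at harc_sq
  rw [hd₁'] at hβ ⊢
  rw [← sub_mul, sub_self, zero_pow two_ne_zero, add_zero, mul_pow] at hD_sq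
  have := mul_sq_mul_le_sub_of_sq_le (Finset.sum_nonneg fun _ _ => sq_nonneg _) dist_nonneg
    ENNReal.toReal_nonneg (by positivity) hsmall₂ hD_sq
    ((add_le_add_right harc_sq _).trans hlow_sq) hβ
  rwa [mul_div_right_comm] at this
end
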